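/- Parafermionic character identity in n variables: Σ_{μ = μ'} (−1)^{(|μ|+r(μ))/2} s_{μ^{(p)}}(x_1,...,x_n) = (Σ_{λ : l(λ') ≤ p} s_λ(x_1,...,x_n)) · Π_i (1 − x_i) · Π_{i<j} (1 − x_i x_j), where the left sum runs over self-conjugate partitions μ with at most n parts (the terms with more than n parts give zero Schur polynomials), and the right sum runs over partitions λ with all parts at most p and at most n rows. -/

import Mathlib

/-!
STATEMENT 10: Parafermionic character identity in n variables:
Σ_{μ = μ'} (−1)^{(|μ|+r(μ))/2} s_{μ^{(p)}}(x_1,...,x_n)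
  = (Σ_{λ : parts ≤ p, at most n rows} s_λ(x_1,...,x_n))
      · Π_i (1 − x_i) · Π_{i<j} (1 − x_i x_j).
The left sum runs over self-conjugate partitions μ with at most n parts
(equivalently, fitting in the n×n square), encoded as antitone functions
Fin n → Fin (n+1); μ^{(p)} is the p-augmentation (α+p | α) in Frobenius
coordinates.  Schur polynomials are given by the Jacobi–Trudi determinant.
-/

open MvPolynomial
open scoped Classical

noncomputable def conjP (μ : ℕ → ℕ) : ℕ → ℕ := fun j => Nat.card {i : ℕ | j < μ i}
noncomputable def psize (μ : ℕ → ℕ) : ℕ := ∑ᶠ i, μ i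
noncomputable def prank (μ : ℕ → ℕ) : ℕ := Nat.card {i : ℕ | i < μ i}

noncomputable def hpoly (n k : ℕ) : MvPolynomial (Fin n) ℤ :=
  ∑ d ∈ Finset.Nat.antidiagonalTuple n k, ∏ i, MvPolynomial.X i ^ d i

noncomputable def hInt (n : ℕ) (k : ℤ) : MvPolynomial (Fin n) ℤ :=
  if 0 ≤ k then hpoly n k.toNat else 0

/-- Jacobi–Trudi Schur polynomial; 0 when λ has more than n parts. -/
noncomputable def schur (n : ℕ) (lam : ℕ → ℕ) : MvPolynomial (Fin n) ℤ :=
  if lam n = 0 then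
    Matrix.det (Matrix.of fun i j : Fin n => hInt n ((lam i : ℤ) + j - i))
  else 0

/-- Extension of a finite tuple to a partition function ℕ → ℕ (zero padded). -/
def extN {n : ℕ} (f : Fin n → ℕ) : ℕ → ℕ := fun i => if h : i < n then f ⟨i, h⟩ else 0

/-- Partition with Frobenius coordinates (α | β), rank r. -/
def frob (r : ℕ) (α β : ℕ → ℕ) : ℕ → ℕ := fun i =>
  if i < r then α i + i + 1
  else ((Finset.range r).filter fun k => i ≤ β k + k).card

/-- The p-augmentation μ^{(p)} = (α + p | α) of a self-conjugate partition μ = (α | α). -/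
noncomputable def augP (p : ℕ) (μ : ℕ → ℕ) : ℕ → ℕ :=
  frob (prank μ) (fun k => (μ k - (k + 1)) + p) (fun k => μ k - (k + 1))

/-- Self-conjugate partitions in the n×n square, encoded by their first n parts. -/
def IsSCBox (n : ℕ) (f : Fin n → Fin (n + 1)) : Prop :=
  Antitone f ∧ conjP (extN fun i => (f i : ℕ)) = extN fun i => (f i : ℕ)

/-- The determinant whose `(i, k)` entry is `x k ^ l i`. -/
def alternant {R : Type*} [CommRing R] {n : ℕ} (x : Fin n → R) (l : Fin n → ℕ) : R :=
  Matrix.det (Matrix.of fun i k => x k ^ l i)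

lemma mk_hpoly (n : ℕ) :
    PowerSeries.mk (hpoly n) =
      ∏ i : Fin n, PowerSeries.mk fun m => (X i : MvPolynomial (Fin n) ℤ) ^ m := by
  ext1 d
  rw [PowerSeries.coeff_prod, PowerSeries.coeff_mk, hpoly]
  refine Finset.sum_nbij' (fun l => Finsupp.equivFunOnFinite.symm l) (fun l => ⇑l) ?_ ?_ ?_ ?_ ?_
  · intro l hl
    rw [Finset.Nat.mem_antidiagonalTuple] at hl
    simp [Finset.mem_finsuppAntidiag, hl]
  · intro l hl
    rw [Finset.mem_finsuppAntidiag] at hl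
    rw [Finset.Nat.mem_antidiagonalTuple]
    exact hl.1
  · intro l _
    rfl
  · intro l _
    ext
    rfl
  · intro l _
    simp

lemma mk_pow_mul_one_sub {R : Type*} [CommRing R] (a : R) :
    (PowerSeries.mk fun m => a ^ m) * (1 - PowerSeries.C a * PowerSeries.X) = 1 := by
  ext m
  rw [mul_sub, mul_one, map_sub, ← mul_assoc]
  cases m with
  | zero => simp
  | succ m => simp [PowerSeries.coeff_succ_mul_X, PowerSeries.coeff_one, pow_succ]

/-- The polynomial `∏_{i ≠ k} (1 - x_i t)` in `t`. -/
noncomputable def omitProd (n : ℕ) (k : Fin n) : Polynomial (MvPolynomial (Fin n) ℤ) :=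
  ∏ i ∈ Finset.univ.erase k, (1 - Polynomial.C (X i) * Polynomial.X)

lemma natDegree_omitProd_lt (n : ℕ) (k : Fin n) : (omitProd n k).natDegree < n := by
  refine lt_of_le_of_lt (Polynomial.natDegree_prod_le _ _) ?_
  have hle : ∑ i ∈ Finset.univ.erase k,
      (1 - Polynomial.C (X i : MvPolynomial (Fin n) ℤ) * Polynomial.X).natDegree ≤
      ∑ i ∈ Finset.univ.erase k, 1 := by
    refine Finset.sum_le_sum fun i _ => ?_
    compute_degree
  refine lt_of_le_of_lt hle ?_
  have := k.pos
  simp [Finset.card_erase_of_mem]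
  omega

lemma mk_hpoly_mul_omitProd (n : ℕ) (k : Fin n) :
    PowerSeries.mk (hpoly n) * (omitProd n k : PowerSeries (MvPolynomial (Fin n) ℤ)) =
      PowerSeries.mk fun m => (X k : MvPolynomial (Fin n) ℤ) ^ m := by
  have hcoe : (omitProd n k : PowerSeries (MvPolynomial (Fin n) ℤ)) =
      ∏ i ∈ Finset.univ.erase k, (1 - PowerSeries.C (X i) * PowerSeries.X) := by
    rw [omitProd, ← Polynomial.coeToPowerSeries.ringHom_apply, map_prod]
    simp
  rw [mk_hpoly, hcoe, ← Finset.mul_prod_erase _ _ (Finset.mem_univ k), mul_assoc,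
    ← Finset.prod_mul_distrib, Finset.prod_congr rfl fun i _ => mk_pow_mul_one_sub (X i),
    Finset.prod_const_one, mul_one]

lemma sum_hInt_mul_coeff (n m : ℕ) (k : Fin n) :
    ∑ b ∈ Finset.range n, hInt n ((m : ℤ) - b) * (omitProd n k).coeff b = X k ^ m := by
  have h := congrArg (PowerSeries.coeff m) (mk_hpoly_mul_omitProd n k)
  rw [PowerSeries.coeff_mul, Finset.Nat.sum_antidiagonal_eq_sum_range_succ_mk,
    ← Finset.sum_range_reflect] at h
  simp only [PowerSeries.coeff_mk, Polynomial.coeff_coe] at h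
  rw [← h]
  have h1 : ∑ b ∈ Finset.range n, hInt n ((m : ℤ) - b) * (omitProd n k).coeff b =
      ∑ b ∈ Finset.range (max n (m + 1)), hInt n ((m : ℤ) - b) * (omitProd n k).coeff b := by
    refine Finset.sum_subset (Finset.range_mono (le_max_left _ _)) fun b _ hb => ?_
    rw [Finset.mem_range, not_lt] at hb
    rw [Polynomial.coeff_eq_zero_of_natDegree_lt
      (lt_of_lt_of_le (natDegree_omitProd_lt n k) hb), mul_zero]
  have h2 : ∑ b ∈ Finset.range (m + 1), hInt n ((m : ℤ) - b) * (omitProd n k).coeff b =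
      ∑ b ∈ Finset.range (max n (m + 1)), hInt n ((m : ℤ) - b) * (omitProd n k).coeff b := by
    refine Finset.sum_subset (Finset.range_mono (le_max_right _ _)) fun b _ hb => ?_
    rw [Finset.mem_range, not_lt] at hb
    rw [hInt, if_neg (by omega), zero_mul]
  rw [h1, ← h2]
  refine Finset.sum_congr rfl fun b hb => ?_
  rw [Finset.mem_range] at hb
  rw [hInt, if_pos (by omega)]
  congr 2
  · omega
  · omega

lemma det_hInt_mul (n : ℕ) (lam : ℕ → ℕ) :
    Matrix.det (Matrix.of fun i j : Fin n => hInt n ((lam i : ℤ) + j - i)) *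
      Matrix.det (Matrix.of fun j k : Fin n => (omitProd n k).coeff (n - 1 - j)) =
      alternant X fun i : Fin n => lam i + (n - 1 - i) := by
  rw [← Matrix.det_mul, alternant]
  congr 1
  ext1 i k
  rw [Matrix.mul_apply, Matrix.of_apply, ← sum_hInt_mul_coeff, ← Finset.sum_range_reflect,
    Finset.sum_range]
  refine Finset.sum_congr rfl fun j _ => ?_
  simp only [Matrix.of_apply]
  congr 2
  omega

lemma schur_mul_alternant (n : ℕ) (lam : ℕ → ℕ) (h : lam n = 0) :
    schur n lam * alternant X (fun i : Fin n => n - 1 - i) =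
      alternant X fun i : Fin n => lam i + (n - 1 - i) := by
  have h0 : Matrix.det (Matrix.of fun i j : Fin n => hInt n (((0 : ℕ) : ℤ) + j - i)) = 1 := by
    rw [Matrix.det_of_isUpperTriangular]
    · refine Finset.prod_eq_one fun i _ => ?_
      have : hpoly n 0 = 1 := by simp [hpoly, Finset.Nat.antidiagonalTuple_zero_right]
      simp [hInt, this]
    · intro i j hij
      have : (j : ℕ) < i := hij
      rw [Matrix.of_apply, hInt, if_neg (by omega)]
  have h1 := det_hInt_mul n fun _ => 0
  rw [h0, one_mul] at h1
  simp only [zero_add] at h1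
  rw [schur, if_pos h, ← h1, det_hInt_mul]

lemma alternant_staircase_ne_zero {R : Type*} [CommRing R] [IsDomain R] {n : ℕ} {x : Fin n → R}
    (hx : Function.Injective x) : alternant x (fun i : Fin n => n - 1 - i) ≠ 0 := by
  have h : (Matrix.of fun i k : Fin n => x k ^ (n - 1 - (i : ℕ))) =
      (Matrix.vandermonde x).transpose.submatrix Fin.revPerm id := by
    ext i k
    simp only [Matrix.of_apply, Matrix.submatrix_apply, Matrix.transpose_apply,
      Matrix.vandermonde_apply, Fin.revPerm_apply, Fin.val_rev, id]
    congr 1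
    omega
  rw [alternant, h, Matrix.det_permute, Matrix.det_transpose]
  refine mul_ne_zero ?_ (Matrix.det_vandermonde_ne_zero_iff.2 hx)
  rcases Int.units_eq_one_or (Equiv.Perm.sign (Fin.revPerm : Equiv.Perm (Fin n))) with h | h <;>
    simp [h]

/-- Self-conjugate partitions with all parts at most `n`, through the symmetry of the diagram. -/
def IsSelfConj (n : ℕ) (μ : ℕ → ℕ) : Prop :=
  (∀ i j, j < μ i → i < μ j) ∧ ∀ i, μ i ≤ n

/-- Add a hook of arm and leg length `n` around a self-conjugate partition. -/
def addHook (n : ℕ) (μ : ℕ → ℕ) : ℕ → ℕ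
  | 0 => n + 1
  | i + 1 => if i < n then μ i + 1 else 0

/-- The self-conjugate partitions in the `n × n` square. -/
noncomputable def selfConjs : ℕ → Finset (ℕ → ℕ)
  | 0 => {fun _ => 0}
  | n + 1 => selfConjs n ∪ (selfConjs n).image (addHook n)

namespace IsSelfConj

variable {n : ℕ} {μ : ℕ → ℕ}

lemma lt_comm (h : IsSelfConj n μ) (i j : ℕ) : j < μ i ↔ i < μ j := ⟨h.1 i j, h.1 j i⟩

lemma antitone (h : IsSelfConj n μ) : Antitone μ := by
  intro i j hij
  by_contra! hlt
  have := h.1 _ _ hlt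
  exact absurd (h.1 _ _ (lt_of_le_of_lt hij this)) (lt_irrefl _)

lemma eq_zero (h : IsSelfConj n μ) {i : ℕ} (hi : n ≤ i) : μ i = 0 := by
  by_contra hne
  have := h.1 i 0 (Nat.pos_of_ne_zero hne)
  have := h.2 0
  omega

lemma addHook (h : IsSelfConj n μ) : IsSelfConj (n + 1) (addHook n μ) := by
  constructor
  · rintro (_ | i) (_ | j) hij
    · exact hij
    · simp only [_root_.addHook] at hij ⊢
      rw [if_pos (by omega)]
      omega
    · simp only [_root_.addHook] at hij ⊢
      split_ifs at hij <;> omega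
    · simp only [_root_.addHook] at hij ⊢
      split_ifs at hij with hi
      · have h1 := h.1 i j (by omega)
        have h2 := h.2 i
        rw [if_pos (by omega)]
        omega
      · omega
  · rintro (_ | i)
    · exact le_rfl
    · have := h.2 i
      simp only [_root_.addHook]
      split_ifs <;> omega

end IsSelfConj

lemma addHook_injOn (n : ℕ) : Set.InjOn (addHook n) {μ | IsSelfConj n μ} := by
  intro μ hμ ν hν heq
  funext i
  by_cases hi : i < n
  · have := congrFun heq (i + 1)
    simpa [addHook, hi] using this
  · rw [hμ.eq_zero (by omega), hν.eq_zero (by omega)]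

lemma mem_selfConjs {n : ℕ} {μ : ℕ → ℕ} : μ ∈ selfConjs n ↔ IsSelfConj n μ := by
  induction n generalizing μ with
  | zero =>
    rw [selfConjs, Finset.mem_singleton]
    constructor
    · rintro rfl
      exact ⟨fun _ _ h => absurd h (Nat.not_lt_zero _), fun _ => le_rfl⟩
    · exact fun h => funext fun i => h.eq_zero (Nat.zero_le i)
  | succ n ih =>
    rw [selfConjs, Finset.mem_union, Finset.mem_image]
    constructor
    · rintro (h | ⟨ν, h, rfl⟩)
      · have := ih.1 h
        exact ⟨this.1, fun i => (this.2 i).trans n.le_succ⟩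
      · exact (ih.1 h).addHook
    · intro h
      by_cases h0 : μ 0 ≤ n
      · exact Or.inl (ih.2 ⟨h.1, fun i => (h.antitone (Nat.zero_le i)).trans h0⟩)
      · have h0' : μ 0 = n + 1 := le_antisymm (h.2 0) (by omega)
        refine Or.inr ⟨fun i => μ (i + 1) - 1, ih.2 ⟨fun i j hij => ?_, fun i => ?_⟩, ?_⟩
        · beta_reduce at hij ⊢
          have := h.1 (i + 1) (j + 1) (by omega)
          omega
        · beta_reduce
          have := h.2 (i + 1)
          omega
        · funext i
          cases i with
          | zero => exact h0'.symm
          | succ i =>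
            simp only [addHook]
            split_ifs with hi
            · have := h.1 0 (i + 1) (by omega)
              omega
            · exact (h.eq_zero (by omega)).symm

lemma disjoint_selfConjs_addHook (n : ℕ) :
    Disjoint (selfConjs n) ((selfConjs n).image (addHook n)) := by
  rw [Finset.disjoint_left]
  intro μ hμ h
  obtain ⟨ν, -, rfl⟩ := Finset.mem_image.1 h
  have := (mem_selfConjs.1 hμ).2 0
  simp only [addHook] at this
  omega

lemma mem_iff_lt_card {s : Set ℕ} {n : ℕ} (hs : ∀ i j, i ≤ j → j ∈ s → i ∈ s)
    (hn : ∀ i ∈ s, i < n) (i : ℕ) : i ∈ s ↔ i < Nat.card s := by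
  obtain ⟨c, rfl⟩ : ∃ c, s = Set.Iio c := by
    refine ⟨sInf sᶜ, ?_⟩
    have hne : (sᶜ).Nonempty := ⟨n, fun h => lt_irrefl _ (hn n h)⟩
    ext j
    rw [Set.mem_Iio]
    constructor
    · intro hj
      by_contra! hle
      exact Nat.sInf_mem hne (hs _ _ hle hj)
    · intro hj
      by_contra hj'
      exact absurd (Nat.sInf_le (s := sᶜ) hj') (by omega)
  simp

lemma lt_conjP_iff {n : ℕ} {μ : ℕ → ℕ} (h : Antitone μ) (hn : ∀ i, n ≤ i → μ i = 0) (i j : ℕ) :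
    i < conjP μ j ↔ j < μ i := by
  refine (mem_iff_lt_card (s := {i | j < μ i}) (n := n) (fun i k hik hk => ?_)
    (fun i hi => ?_) i).symm
  · exact lt_of_lt_of_le hk (h hik)
  · by_contra! hle
    have hi' : j < μ i := hi
    rw [hn i hle] at hi'
    omega

namespace IsSelfConj

variable {n : ℕ} {μ : ℕ → ℕ}

lemma lt_prank_iff (h : IsSelfConj n μ) (i : ℕ) : i < prank μ ↔ i < μ i := by
  refine (mem_iff_lt_card (s := {i | i < μ i}) (n := n) (fun i j hij hj => ?_)
    (fun i hi => lt_of_lt_of_le hi (h.2 i)) i).symm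
  have := h.antitone hij
  have hj' : j < μ j := hj
  show i < μ i
  omega

lemma augP_apply (h : IsSelfConj n μ) (p i : ℕ) :
    augP p μ i = μ i + if i < μ i then p else 0 := by
  rw [augP, frob]
  by_cases hi : i < μ i
  · rw [if_pos ((h.lt_prank_iff i).2 hi), if_pos hi]
    omega
  · rw [if_neg fun hlt => hi ((h.lt_prank_iff i).1 hlt), if_neg hi, add_zero]
    convert Finset.card_range (μ i)
    ext k
    rw [Finset.mem_filter, Finset.mem_range, Finset.mem_range, h.lt_prank_iff, h.lt_comm i k]
    constructor
    · omega
    · intro hk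
      have hk' : k < μ i := (h.lt_comm i k).2 hk
      omega

lemma psize_eq (h : IsSelfConj n μ) : psize μ = ∑ i ∈ Finset.range n, μ i := by
  refine finsum_eq_sum_of_support_subset _ fun i hi => ?_
  rw [Finset.coe_range, Set.mem_Iio]
  by_contra! hle
  exact hi (h.eq_zero hle)

lemma psize_addHook (h : IsSelfConj n μ) : psize (_root_.addHook n μ) = psize μ + (2 * n + 1) := by
  rw [h.addHook.psize_eq, h.psize_eq, Finset.sum_range_succ']
  have : ∀ i ∈ Finset.range n, _root_.addHook n μ (i + 1) = μ i + 1 := by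
    intro i hi
    simp [_root_.addHook, Finset.mem_range.1 hi]
  rw [Finset.sum_congr rfl this, Finset.sum_add_distrib]
  simp [_root_.addHook]
  omega

lemma prank_addHook (h : IsSelfConj n μ) : prank (_root_.addHook n μ) = prank μ + 1 := by
  refine eq_of_forall_lt_iff fun i => ?_
  rw [h.addHook.lt_prank_iff]
  cases i with
  | zero => simp [_root_.addHook]
  | succ i =>
    rw [Nat.add_lt_add_iff_right, h.lt_prank_iff]
    simp only [_root_.addHook]
    split_ifs with hi
    · omega
    · rw [h.eq_zero (by omega)]
      omega

end IsSelfConj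

/-- The `i`-th entry of the tuple attached to a self-conjugate `μ` in the `n × n` square: with
`l = μ i + n - 1 - i`, it is `u l` when `l < n` and `v (2 * n - 1 - l)` otherwise. -/
def selectRow {M : Type*} (n : ℕ) (u v : ℕ → M) (μ : ℕ → ℕ) (i : ℕ) : M :=
  if i < μ i then v (n + i - μ i) else u (n - 1 - i + μ i)

lemma succ_mul_self_div_two (n : ℕ) : (n + 1) * (n + 1 - 1) / 2 = n * (n - 1) / 2 + n := by
  rw [← Nat.choose_two_right, ← Nat.choose_two_right, Nat.choose_succ_succ' n 1,
    Nat.choose_one_right, add_comm]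

lemma sum_selfConjs_alternating {R M N : Type*} [CommRing R] [AddCommGroup M] [Module R M]
    [AddCommGroup N] [Module R N] (n : ℕ) (u v : ℕ → M) (f : M [⋀^Fin n]→ₗ[R] N) :
    ∑ μ ∈ selfConjs n, (-1 : ℤ) ^ ((psize μ + prank μ) / 2) •
        f (fun i => selectRow n u v μ i) =
      (-1 : ℤ) ^ (n * (n - 1) / 2) • f fun i => u i - v i := by
  induction n generalizing u v with
  | zero =>
    have h : IsSelfConj 0 (fun _ => 0) := mem_selfConjs.1 (by simp [selfConjs])
    have hr : prank (fun _ => 0) = 0 := by simp [prank]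
    rw [selfConjs, Finset.sum_singleton, h.psize_eq, hr]
    simp only [Finset.range_zero, Finset.sum_empty]
    congr 2
    exact Subsingleton.elim _ _
  | succ n ih =>
    rw [selfConjs, Finset.sum_union (disjoint_selfConjs_addHook n), Finset.sum_image
      fun μ hμ ν hν => addHook_injOn n (mem_selfConjs.1 hμ) (mem_selfConjs.1 hν)]
    have hu : ∀ μ ∈ selfConjs n, f (fun i => selectRow (n + 1) u v μ i) =
        (-1 : ℤ) ^ n • f.curryLeft (u 0)
          fun i => selectRow n (fun j => u (j + 1)) (fun j => v (j + 1)) μ i := by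
      intro μ hμ
      have hμ := mem_selfConjs.1 hμ
      have hsnoc : (fun i : Fin (n + 1) => selectRow (n + 1) u v μ i) =
          Fin.snoc (α := fun _ => M)
            (fun i : Fin n => selectRow n (fun j => u (j + 1)) (fun j => v (j + 1)) μ i) (u 0) := by
        funext i
        refine Fin.lastCases ?_ (fun i => ?_) i
        · simp [selectRow, hμ.eq_zero le_rfl]
        · rw [Fin.snoc_castSucc]
          have := hμ.2 i
          simp only [selectRow, Fin.val_castSucc]
          split_ifs with hi
          · congr 1
            omega
          · congr 1
            omega
      rw [hsnoc, Fin.snoc_eq_cons_rotate, ← Function.comp_def, f.map_perm, sign_finRotate,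
        AlternatingMap.curryLeft_apply_apply]
      simp [Units.smul_def, Matrix.vecCons]
    have hv : ∀ μ ∈ selfConjs n, f (fun i => selectRow (n + 1) u v (addHook n μ) i) =
        f.curryLeft (v 0)
          fun i => selectRow n (fun j => u (j + 1)) (fun j => v (j + 1)) μ i := by
      intro μ hμ
      have hμ := mem_selfConjs.1 hμ
      rw [AlternatingMap.curryLeft_apply_apply]
      congr 1
      funext i
      refine Fin.cases ?_ (fun i => ?_) i
      · simp [selectRow, addHook]
      · have := hμ.2 i
        simp only [selectRow, addHook, Fin.val_succ, Matrix.cons_val_succ, Fin.is_lt, if_true,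
          Nat.add_lt_add_iff_right]
        split_ifs with hi
        · congr 1
          omega
        · congr 1
          omega
    have hsign : ∀ μ ∈ selfConjs n, (-1 : ℤ) ^ ((psize (addHook n μ) + prank (addHook n μ)) / 2) =
        (-1) ^ ((psize μ + prank μ) / 2) * (-1) ^ (n + 1) := by
      intro μ hμ
      have hμ := mem_selfConjs.1 hμ
      rw [hμ.psize_addHook, hμ.prank_addHook, ← pow_add]
      congr 1
      omega
    have hcons : (fun i : Fin (n + 1) => u i - v i) =
        Matrix.vecCons (u 0 - v 0) fun i : Fin n => u (i + 1) - v (i + 1) := by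
      funext i
      refine Fin.cases ?_ (fun i => ?_) i <;> simp
    rw [succ_mul_self_div_two, hcons, ← AlternatingMap.curryLeft_apply_apply, pow_add, mul_comm, mul_smul,
      ← ih (fun j => u (j + 1)) (fun j => v (j + 1)), map_sub, ← Finset.sum_add_distrib,
      Finset.smul_sum]
    refine Finset.sum_congr rfl fun μ hμ => ?_
    rw [hu μ hμ, hv μ hμ, hsign μ hμ, AlternatingMap.sub_apply, pow_succ, mul_smul, smul_comm ((-1 : ℤ) ^ n),
      ← smul_add,
      mul_neg_one, neg_smul, ← sub_eq_add_neg, ← smul_sub]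

/-- The determinant whose `(j, k)` entry is `x k ^ j - x k ^ (N + n - 1 - j)`. -/
def oddAlternant {R : Type*} [CommRing R] {n : ℕ} (N : ℕ) (x : Fin n → R) : R :=
  Matrix.det (Matrix.of fun j k : Fin n => x k ^ (j : ℕ) - x k ^ (N + n - 1 - j))

lemma exists_prod_sub_eq {K : Type*} [Field K] (n : ℕ) (x : Fin (n + 1) → K) :
    ∃ q : Fin n → K, ∀ z, ∏ i, (z - x i) =
      (∏ i, (0 - x i)) * (z + 1) - (∏ i, (-1 - x i)) * z +
        z * (z + 1) * ∑ j : Fin n, q j * z ^ (j : ℕ) := by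
  cases n with
  | zero => exact ⟨0, fun z => by simp; ring⟩
  | succ n =>
    let r : Polynomial K := ∏ i, (Polynomial.X - Polynomial.C (x i))
    let d : Polynomial K := Polynomial.X * (Polynomial.X - Polynomial.C (-1))
    have hd : d.Monic := Polynomial.monic_X.mul (Polynomial.monic_X_sub_C _)
    have hdeg : d.natDegree = 2 := by
      rw [Polynomial.Monic.natDegree_mul Polynomial.monic_X (Polynomial.monic_X_sub_C _),
        Polynomial.natDegree_X, Polynomial.natDegree_X_sub_C]
    have hr : r.natDegree = n + 2 := by
      rw [Polynomial.natDegree_prod_of_monic _ _ fun i _ => Polynomial.monic_X_sub_C _]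
      simp
    have heval : ∀ z, r.eval z = ∏ i, (z - x i) := fun z => by simp [r, Polynomial.eval_prod]
    let s : Polynomial K :=
      Polynomial.C (r.eval 0) * (Polynomial.X + 1) - Polynomial.C (r.eval (-1)) * Polynomial.X
    have hs : s.natDegree ≤ 1 := by
      simp only [s]
      compute_degree
    have hdvd : d ∣ r - s := by
      refine IsCoprime.mul_dvd ?_ ?_ ?_
      · exact ⟨-1, 1, by simp⟩
      · rw [Polynomial.X_dvd_iff, Polynomial.coeff_zero_eq_eval_zero]
        simp [s]
      · rw [Polynomial.dvd_iff_isRoot]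
        simp [s]
    obtain ⟨q, hq⟩ := hdvd
    have hqdeg : q.natDegree < n + 1 := by
      by_cases hq0 : q = 0
      · simp [hq0]
      have h1 := hd.natDegree_mul' hq0
      have h2 : s.natDegree ≤ n + 2 := by omega
      have h3 := (Polynomial.natDegree_sub_le r _).trans (max_le hr.le h2)
      rw [hq, h1, hdeg] at h3
      omega
    refine ⟨fun j => q.coeff j, fun z => ?_⟩
    have hz := congrArg (Polynomial.eval z) hq
    rw [Polynomial.eval_mul, Polynomial.eval_eq_sum_range' hqdeg, Finset.sum_range] at hz
    simp only [Polynomial.eval_sub, Polynomial.eval_mul, Polynomial.eval_C, Polynomial.eval_add,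
      Polynomial.eval_X, Polynomial.eval_one, d, s] at hz
    rw [← heval, ← heval, ← heval]
    linear_combination hz

lemma det_vecCons_sum_eq_zero {R : Type*} [CommRing R] {n : ℕ} (q : Fin n → R)
    (b : Fin n → Fin (n + 1) → R) :
    Matrix.det (Matrix.of (Matrix.vecCons (∑ j, q j • b j) b)) = 0 := by
  have hupd : ∀ v, Matrix.vecCons v b = Function.update (Matrix.vecCons 0 b) 0 v := fun v =>
    (Fin.update_cons_zero (α := fun _ => Fin (n + 1) → R) 0 b v).symm
  have h : Matrix.detRowAlternating (Matrix.vecCons (∑ j, q j • b j) b) = 0 := by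
    rw [hupd, AlternatingMap.map_update_sum]
    refine Finset.sum_eq_zero fun j _ => ?_
    rw [AlternatingMap.map_update_smul, ← hupd,
      Matrix.detRowAlternating.map_eq_zero_of_eq _ (i := 0) (j := j.succ) (by simp)
      (Fin.succ_ne_zero j).symm, smul_zero]
  exact h

section Recurrence

variable {K : Type*} [Field K] {n : ℕ} (N : ℕ) (x : Fin (n + 1) → K)

lemma oddAlternant_succ_eq (hx : ∀ k, x k ≠ 0) :
    oddAlternant (N + 1) x = (∏ k, x k) * Matrix.det (Matrix.of (Matrix.vecCons
      (fun k => (1 - x k ^ (N + n + 1)) / x k)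
      fun (j : Fin n) k => x k ^ (j : ℕ) - x k ^ (N + n - 1 - j))) := by
  rw [oddAlternant, ← Matrix.det_mul_row]
  congr 1
  ext j k
  refine Fin.cases ?_ (fun j => ?_) j
  · have := hx k
    simp only [Matrix.of_apply, Matrix.cons_val_zero, Fin.val_zero]
    rw [pow_zero, mul_div_cancel₀ _ this]
    congr 2
    omega
  · simp only [Matrix.of_apply, Matrix.cons_val_succ, Fin.val_succ]
    rw [mul_sub, ← pow_succ', ← pow_succ']
    congr 2
    omega

lemma oddAlternant_eq (hx : ∀ k, 1 + x k ≠ 0) :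
    oddAlternant N x = (∏ k, (1 + x k)) * Matrix.det (Matrix.of (Matrix.vecCons
      (fun k => (1 - x k ^ (N + n)) / (1 + x k))
      fun (j : Fin n) k => x k ^ (j : ℕ) - x k ^ (N + n - 1 - j))) := by
  rw [oddAlternant, ← Matrix.det_mul_row]
  refine Matrix.det_eq_of_forall_row_eq_smul_add_pred (fun _ => -1) (fun k => ?_) fun j k => ?_
  · have := hx k
    simp only [Matrix.of_apply, Matrix.cons_val_zero, Fin.val_zero]
    field_simp
    simp
  · simp only [Matrix.of_apply, Matrix.cons_val_succ, Fin.val_succ, Fin.val_castSucc]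
    obtain ⟨m, hm⟩ : ∃ m, N + n - 1 - j = m := ⟨_, rfl⟩
    rw [show N + (n + 1) - 1 - (j + 1) = m by omega, show N + (n + 1) - 1 - j = m + 1 by omega, hm]
    ring

lemma sum_mul_oddAlternant_eq (w : Fin (n + 1) → K) :
    ∑ k : Fin (n + 1), (-1) ^ (k : ℕ) * w k * oddAlternant N (fun j => x (k.succAbove j)) =
      Matrix.det (Matrix.of (Matrix.vecCons w
        fun (j : Fin n) k => x k ^ (j : ℕ) - x k ^ (N + n - 1 - j))) := by
  rw [Matrix.det_succ_row_zero]
  rfl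

lemma oddAlternant_recurrence (h0 : ∀ k, x k ≠ 0) (h1 : ∀ k, 1 + x k ≠ 0) :
    oddAlternant (N + 1) x = oddAlternant N x + (-1) ^ n *
      ∑ k : Fin (n + 1), (-1) ^ (k : ℕ) * (x k ^ N * ((1 - x k) * ∏ j, (1 - x k * x (k.succAbove j)))) *
        oddAlternant N (fun j => x (k.succAbove j)) := by
  rw [sum_mul_oddAlternant_eq, oddAlternant_succ_eq N x h0, oddAlternant_eq N x h1]
  obtain ⟨q, hq⟩ := exists_prod_sub_eq n x
  set b : Fin n → Fin (n + 1) → K := fun j k => x k ^ (j : ℕ) - x k ^ (N + n - 1 - j) with hb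
  set y₁ : Fin (n + 1) → K := fun k => (1 - x k ^ (N + n + 1)) / x k with hy₁
  set y₂ : Fin (n + 1) → K := fun k => (1 - x k ^ (N + n)) / (1 + x k) with hy₂
  set w : Fin (n + 1) → K :=
    fun k => x k ^ N * ((1 - x k) * ∏ j, (1 - x k * x (k.succAbove j))) with hw
  have key : ∑ j, q j • b j =
      (-1 : K) ^ n • ((∏ k, x k) • y₁ - (∏ k, (1 + x k)) • y₂) - w := by
    funext k
    have hxk := h0 k
    have hxk' := h1 k
    have e0 : ∏ i, (0 - x i) = (-1) ^ (n + 1) * ∏ i, x i := by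
      simp [Finset.prod_neg]
    have e1 : ∏ i, (-1 - x i) = (-1) ^ (n + 1) * ∏ i, (1 + x i) := by
      rw [show (fun i => -1 - x i) = fun i => -(1 + x i) by funext i; ring, Finset.prod_neg]
      simp
    have ex : ∏ i, (x k - x i) = 0 := Finset.prod_eq_zero (Finset.mem_univ k) (sub_self _)
    have ez : (∏ i, ((x k)⁻¹ - x i)) * x k ^ (n + 1) =
        (1 - x k ^ 2) * ∏ j, (1 - x k * x (k.succAbove j)) := by
      rw [show x k ^ (n + 1) = ∏ _i : Fin (n + 1), x k by simp, ← Finset.prod_mul_distrib,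
        Fin.prod_univ_succAbove _ k]
      congr 1
      · field_simp
      · refine Finset.prod_congr rfl fun j _ => ?_
        field_simp
    have hsum : (∑ j, q j • b j) k =
        (∑ j : Fin n, q j * x k ^ (j : ℕ)) -
          x k ^ (N + n) / x k * ∑ j : Fin n, q j * (x k)⁻¹ ^ (j : ℕ) := by
      rw [Finset.sum_apply, Finset.mul_sum, ← Finset.sum_sub_distrib]
      refine Finset.sum_congr rfl fun j _ => ?_
      have hexp : N + n = (N + n - 1 - j) + 1 + j := by omega
      rw [Pi.smul_apply, smul_eq_mul, hb, mul_sub, hexp]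
      generalize N + n - 1 - (j : ℕ) = m
      rw [show m + 1 + (j : ℕ) - 1 - j = m by omega, pow_add, pow_succ, inv_pow]
      field_simp
    have hx := hq (x k)
    have hz := hq (x k)⁻¹
    rw [ex, e0, e1] at hx
    rw [e0, e1] at hz
    rw [hsum]
    simp only [Pi.sub_apply, Pi.smul_apply, smul_eq_mul, hy₁, hy₂, hw]
    generalize (∑ j : Fin n, q j * x k ^ (j : ℕ)) = S at *
    generalize (∑ j : Fin n, q j * (x k)⁻¹ ^ (j : ℕ)) = T at *
    generalize (∏ i, ((x k)⁻¹ - x i)) = Z at *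
    generalize (∏ j, (1 - x k * x (k.succAbove j))) = W at *
    have hS : S = (-1) ^ n * ((∏ i, x i) / x k - (∏ i, (1 + x i)) / (1 + x k)) := by
      field_simp
      linear_combination -hx
    have hW : (1 - x k) * W = Z * x k ^ (n + 1) / (1 + x k) := by
      field_simp
      linear_combination -ez
    rw [hW, hz, hS]
    field_simp
    ring
  have hdet := det_vecCons_sum_eq_zero q b
  rw [key] at hdet
  have hlin : ∀ v : Fin (n + 1) → K, Matrix.det (Matrix.of (Matrix.vecCons v b)) =
      Matrix.detRowAlternating.curryLeft v b := fun v => rfl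
  rw [hlin, map_sub, map_smul, map_sub, map_smul, map_smul] at hdet
  simp only [AlternatingMap.sub_apply, AlternatingMap.smul_apply, smul_eq_mul] at hdet
  rw [hlin, hlin, hlin]
  have hsq : ((-1 : K) ^ n) * (-1) ^ n = 1 := by rw [← mul_pow]; simp
  linear_combination (-1) ^ n * hdet - ((∏ k, x k) * Matrix.detRowAlternating.curryLeft y₁ b -
    (∏ k, (1 + x k)) * Matrix.detRowAlternating.curryLeft y₂ b) * hsq

end Recurrence

lemma oddAlternant_zero {R : Type*} [CommRing R] {n : ℕ} (x : Fin (n + 1) → R) :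
    oddAlternant 0 x = 0 := by
  cases n with
  | zero => simp [oddAlternant]
  | succ n =>
    rw [oddAlternant, ← Matrix.det_updateRow_add_self _ (i := 0) (j := Fin.last _)
      (Fin.last_pos.ne)]
    refine Matrix.det_eq_zero_of_row_eq_zero 0 fun k => ?_
    simp

/-- The strictly decreasing `n`-tuples of natural numbers less than `N`. -/
noncomputable def strictTuples (n N : ℕ) : Finset (Fin n → ℕ) :=
  (Fintype.piFinset fun _ => Finset.range N).filter StrictAnti

lemma mem_strictTuples {n N : ℕ} {l : Fin n → ℕ} :
    l ∈ strictTuples n N ↔ (∀ i, l i < N) ∧ StrictAnti l := by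
  simp [strictTuples]

lemma strictAnti_cons_iff {n : ℕ} {a : ℕ} {l : Fin n → ℕ} :
    StrictAnti (Fin.cons a l : Fin (n + 1) → ℕ) ↔ (∀ i, l i < a) ∧ StrictAnti l := by
  constructor
  · intro h
    exact ⟨fun i => by simpa using h (Fin.succ_pos i),
      fun i j hij => by simpa using h (Fin.succ_lt_succ_iff.2 hij)⟩
  · rintro ⟨ha, h⟩ i j hij
    cases j using Fin.cases with
    | zero => exact absurd hij (Fin.not_lt_zero i)
    | succ j =>
      cases i using Fin.cases with
      | zero => simpa using ha j
      | succ i => simpa using h (Fin.succ_lt_succ_iff.1 hij)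

lemma strictTuples_succ (n N : ℕ) :
    strictTuples (n + 1) (N + 1) =
      strictTuples (n + 1) N ∪ (strictTuples n N).image (Fin.cons (α := fun _ => ℕ) N) := by
  ext l
  obtain ⟨a, l, rfl⟩ : ∃ a l', l = Fin.cons (α := fun _ => ℕ) a l' :=
    ⟨l 0, Fin.tail l, (Fin.cons_self_tail l).symm⟩
  rw [Finset.mem_union, Finset.mem_image, mem_strictTuples, mem_strictTuples, strictAnti_cons_iff]
  simp only [Fin.forall_fin_succ, Fin.cons_zero, Fin.cons_succ, mem_strictTuples]
  constructor
  · rintro ⟨⟨ha, -⟩, hl, hanti⟩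
    rcases Nat.lt_succ_iff_lt_or_eq.1 ha with h | rfl
    · exact Or.inl ⟨⟨h, fun i => (hl i).trans h⟩, hl, hanti⟩
    · exact Or.inr ⟨l, ⟨hl, hanti⟩, rfl⟩
  · rintro (⟨⟨ha, h⟩, hl⟩ | ⟨l', ⟨h, hanti⟩, heq⟩)
    · exact ⟨⟨by omega, fun i => (h i).trans N.lt_succ_self⟩, hl⟩
    · obtain ⟨rfl, rfl⟩ := Fin.cons_inj.1 heq
      exact ⟨⟨N.lt_succ_self, fun i => (h i).trans N.lt_succ_self⟩, h, hanti⟩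

lemma StrictAnti.add_sub_le {n : ℕ} {l : Fin n → ℕ} (h : StrictAnti l) {i j : Fin n}
    (hij : i ≤ j) : l j + (j - i : ℕ) ≤ l i := by
  obtain ⟨j, hj⟩ := j
  induction j with
  | zero => exact (h.antitone hij).trans' (by simp)
  | succ j ih =>
    rcases hij.eq_or_lt with rfl | hlt
    · simp
    · have hlt' : (i : ℕ) < j + 1 := hlt
      have h1 := ih (by omega) (Fin.le_def.2 (by simp; omega))
      have h2 : l ⟨j + 1, hj⟩ < l ⟨j, by omega⟩ := h (Fin.mk_lt_mk.2 j.lt_succ_self)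
      simp only at h1 ⊢
      omega

/-- The sum of all alternants with strictly decreasing exponents less than `N`. -/
noncomputable def alternantSum {R : Type*} [CommRing R] {n : ℕ} (N : ℕ) (x : Fin n → R) : R :=
  ∑ l ∈ strictTuples n N, alternant x l

lemma alternantSum_succ {R : Type*} [CommRing R] {n : ℕ} (N : ℕ) (x : Fin (n + 1) → R) :
    alternantSum (N + 1) x = alternantSum N x +
      ∑ k : Fin (n + 1), (-1) ^ (k : ℕ) * x k ^ N * alternantSum N fun j => x (k.succAbove j) := by
  have hdisj : Disjoint (strictTuples (n + 1) N)
      ((strictTuples n N).image (Fin.cons (α := fun _ => ℕ) N)) := by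
    rw [Finset.disjoint_left]
    intro l hl h
    obtain ⟨l', -, rfl⟩ := Finset.mem_image.1 h
    exact lt_irrefl _ ((mem_strictTuples.1 hl).1 0)
  rw [alternantSum, strictTuples_succ, Finset.sum_union hdisj,
    Finset.sum_image fun _ _ _ _ h => (Fin.cons_inj.1 h).2]
  simp only [alternantSum, Finset.mul_sum]
  rw [Finset.sum_comm]
  congr 1
  refine Finset.sum_congr rfl fun l _ => ?_
  rw [alternant, Matrix.det_succ_row_zero]
  rfl

/-- The product `∏ (1 - x i) * ∏_{i < j} (1 - x i * x j)`. -/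
def pairProd {R : Type*} [CommRing R] {n : ℕ} (x : Fin n → R) : R :=
  (∏ i, (1 - x i)) *
    ∏ q ∈ Finset.univ.filter (fun q : Fin n × Fin n => q.1 < q.2), (1 - x q.1 * x q.2)

lemma pairProd_succAbove {R : Type*} [CommRing R] {n : ℕ} (x : Fin (n + 1) → R)
    (k : Fin (n + 1)) :
    pairProd x = (1 - x k) * (∏ j, (1 - x k * x (k.succAbove j))) *
      pairProd fun j => x (k.succAbove j) := by
  have hcross : ∏ j, (1 - x k * x (k.succAbove j)) =
      (∏ j, if k < k.succAbove j then 1 - x k * x (k.succAbove j) else 1) *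
        ∏ j, if k.succAbove j < k then 1 - x (k.succAbove j) * x k else 1 := by
    rw [← Finset.prod_mul_distrib]
    refine Finset.prod_congr rfl fun j _ => ?_
    rcases lt_or_gt_of_ne (Fin.succAbove_ne k j) with h | h
    · rw [if_neg h.not_gt, if_pos h, one_mul, mul_comm]
    · rw [if_pos h, if_neg h.not_gt, mul_one]
  simp only [pairProd, Finset.prod_filter, Fintype.prod_prod_type]
  rw [hcross, Fin.prod_univ_succAbove _ k, Fin.prod_univ_succAbove _ k,
    Fin.prod_univ_succAbove _ k, if_neg (lt_irrefl k)]
  simp_rw [Fin.prod_univ_succAbove _ k, Finset.prod_mul_distrib, Fin.succAbove_lt_succAbove_iff]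
  ring

lemma alternantSum_mul_pairProd {K : Type*} [Field K] {n : ℕ} (N : ℕ) (x : Fin n → K)
    (h0 : ∀ k, x k ≠ 0) (h1 : ∀ k, 1 + x k ≠ 0) :
    alternantSum N x * pairProd x = (-1) ^ (n * (n - 1) / 2) * oddAlternant N x := by
  induction N generalizing n with
  | zero =>
    cases n with
    | zero =>
      simp [alternantSum, pairProd, oddAlternant, strictTuples, alternant, Finset.filter_true_of_mem,
        Subsingleton.strictAnti]
    | succ n =>
      have : strictTuples (n + 1) 0 = ∅ := by
        refine Finset.eq_empty_of_forall_notMem fun l hl => ?_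
        exact Nat.not_lt_zero _ ((mem_strictTuples.1 hl).1 0)
      rw [oddAlternant_zero, alternantSum, this]
      simp
  | succ N ih =>
    cases n with
    | zero =>
      simp [alternantSum, pairProd, oddAlternant, strictTuples, alternant,
        Finset.filter_true_of_mem, Subsingleton.strictAnti]
    | succ n =>
      have hsq : ((-1 : K) ^ n) * (-1) ^ n = 1 := by rw [← mul_pow]; simp
      rw [alternantSum_succ, add_mul, ih x h0 h1, oddAlternant_recurrence N x h0 h1, mul_add,
        ← mul_assoc ((-1) ^ ((n + 1) * (n + 1 - 1) / 2)), succ_mul_self_div_two, pow_add,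
        mul_assoc _ _ ((-1) ^ n), hsq, mul_one, Finset.sum_mul, Finset.mul_sum]
      congr 1
      refine Finset.sum_congr rfl fun k _ => ?_
      have := ih (fun j => x (k.succAbove j)) (fun j => h0 _) (fun j => h1 _)
      rw [pairProd_succAbove x k]
      linear_combination (-1) ^ (k : ℕ) * x k ^ N *
        ((1 - x k) * ∏ j, (1 - x k * x (k.succAbove j))) * this

lemma map_alternant {R S : Type*} [CommRing R] [CommRing S] (φ : R →+* S) {n : ℕ}
    (x : Fin n → R) (l : Fin n → ℕ) : φ (alternant x l) = alternant (fun k => φ (x k)) l := by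
  rw [alternant, RingHom.map_det]
  congr 1
  ext
  simp

lemma alternantSum_X_mul_pairProd (n N : ℕ) :
    alternantSum N (X : Fin n → MvPolynomial (Fin n) ℤ) * pairProd X =
      (-1) ^ (n * (n - 1) / 2) * oddAlternant N X := by
  let φ := algebraMap (MvPolynomial (Fin n) ℤ) (FractionRing (MvPolynomial (Fin n) ℤ))
  have hφ : Function.Injective φ := IsFractionRing.injective _ _
  apply hφ
  have h := alternantSum_mul_pairProd N (fun k : Fin n => φ (X k))
    (fun k => (map_ne_zero_iff φ hφ).2 (X_ne_zero k))
    (fun k => by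
      rw [← map_one φ, ← map_add, map_ne_zero_iff φ hφ]
      intro hk
      simpa using congrArg constantCoeff hk)
  have hodd : φ (oddAlternant N X) = oddAlternant N fun k : Fin n => φ (X k) := by
    rw [oddAlternant, RingHom.map_det]
    congr 1
    ext
    simp
  have hpair : φ (pairProd X) = pairProd fun k : Fin n => φ (X k) := by
    simp [pairProd]
  have hsum : φ (alternantSum N X) = alternantSum N fun k : Fin n => φ (X k) := by
    simp [alternantSum, map_alternant]
  rw [map_mul, map_mul, hodd, hpair, hsum, h]
  simp

lemma sum_antitone_schur (n p : ℕ) :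
    (∑ g : {g : Fin n → Fin (p + 1) // Antitone g},
        schur n (extN fun i => ((g : Fin n → Fin (p + 1)) i : ℕ))) *
      alternant X (fun i : Fin n => n - 1 - i) = alternantSum (p + n) X := by
  rw [Finset.sum_mul, alternantSum]
  have hext : ∀ (g : Fin n → Fin (p + 1)) (i : Fin n), extN (fun i => (g i : ℕ)) i = g i :=
    fun g i => by simp [extN]
  refine Finset.sum_bij (fun g _ i => (g.1 i : ℕ) + (n - 1 - i)) ?_ ?_ ?_ ?_
  · intro g _
    rw [mem_strictTuples]
    refine ⟨fun i => ?_, fun i j hij => ?_⟩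
    · have := (g.1 i).is_lt
      have := i.is_lt
      omega
    · have h1 : (g.1 j : ℕ) ≤ g.1 i := g.2 hij.le
      have h2 : (i : ℕ) < j := hij
      have := j.is_lt
      beta_reduce
      omega
  · intro g _ g' _ h
    ext i
    have := congrFun h i
    beta_reduce at this
    omega
  · intro l hl
    obtain ⟨hlt, hanti⟩ := mem_strictTuples.1 hl
    have hge : ∀ i : Fin n, n - 1 - i ≤ l i := by
      intro i
      have hi := i.is_lt
      have := hanti.add_sub_le (i := i) (j := ⟨n - 1, by omega⟩) (Fin.le_def.2 (by simp; omega))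
      simp only at this
      omega
    have hle : ∀ i : Fin n, l i - (n - 1 - i) < p + 1 := by
      intro i
      have hi := i.is_lt
      have := hanti.add_sub_le (i := ⟨0, by omega⟩) (j := i) (Fin.le_def.2 (by simp))
      have := hlt ⟨0, by omega⟩
      simp only at *
      omega
    refine ⟨⟨fun i => ⟨l i - (n - 1 - i), hle i⟩, fun i j hij => ?_⟩, Finset.mem_univ _, ?_⟩
    · have h1 := hanti.add_sub_le hij
      have h2 : (i : ℕ) ≤ j := hij
      have := j.is_lt
      rw [Fin.mk_le_mk]
      omega
    · funext i
      have := hge i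
      simp only
      omega
  · intro g _
    rw [schur_mul_alternant _ _ (by simp [extN])]
    simp only [hext]

lemma isSCBox_iff {n : ℕ} (f : Fin n → Fin (n + 1)) :
    IsSCBox n f ↔ IsSelfConj n (extN fun i => (f i : ℕ)) := by
  have hle : ∀ i, extN (fun i => (f i : ℕ)) i ≤ n := by
    intro i
    simp only [extN]
    split_ifs with h
    · exact Nat.lt_succ_iff.1 (f ⟨i, h⟩).is_lt
    · exact Nat.zero_le n
  have hzero : ∀ i, n ≤ i → extN (fun i => (f i : ℕ)) i = 0 := by
    intro i hi
    simp [extN, hi.not_gt]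
  constructor
  · rintro ⟨hanti, hconj⟩
    have hμ : Antitone (extN fun i => (f i : ℕ)) := by
      intro i j hij
      by_cases hj : j < n
      · have h : f ⟨j, hj⟩ ≤ f ⟨i, hij.trans_lt hj⟩ := hanti hij
        simpa [extN, hj, hij.trans_lt hj] using h
      · rw [hzero j (by omega)]
        exact Nat.zero_le _
    refine ⟨fun i j h => ?_, hle⟩
    rw [← hconj]
    exact (lt_conjP_iff hμ hzero i j).2 h
  · intro h
    refine ⟨fun i j hij => ?_, ?_⟩
    · have := h.antitone (show (i : ℕ) ≤ j from hij)
      simpa [extN] using this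
    · funext j
      refine eq_of_forall_lt_iff fun i => ?_
      rw [lt_conjP_iff h.antitone hzero, h.lt_comm]

lemma sum_isSCBox {M : Type*} [AddCommMonoid M] (n : ℕ) (F : (ℕ → ℕ) → M) :
    ∑ f : {f : Fin n → Fin (n + 1) // IsSCBox n f},
        F (extN fun i => ((f : Fin n → Fin (n + 1)) i : ℕ)) =
      ∑ μ ∈ selfConjs n, F μ := by
  refine Finset.sum_bij (fun f _ => extN fun i => (f.1 i : ℕ)) ?_ ?_ ?_ ?_
  · exact fun f _ => mem_selfConjs.2 ((isSCBox_iff f.1).1 f.2)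
  · intro f _ g _ h
    ext i
    simpa [extN] using congrFun h i
  · intro μ hμ
    have hμ := mem_selfConjs.1 hμ
    have heq : (extN fun i : Fin n => μ i) = μ := by
      funext i
      by_cases hi : i < n
      · simp [extN, hi]
      · simp [extN, hi, hμ.eq_zero (by omega : n ≤ i)]
    exact ⟨⟨fun i => ⟨μ i, Nat.lt_succ_iff.2 (hμ.2 i)⟩, (isSCBox_iff _).2 (by simpa only [heq])⟩,
      Finset.mem_univ _, heq⟩
  · exact fun _ _ => rfl

lemma sum_selfConjs_schur (n p : ℕ) :
    (∑ μ ∈ selfConjs n, (-1 : MvPolynomial (Fin n) ℤ) ^ ((psize μ + prank μ) / 2) *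
        schur n (augP p μ)) * alternant X (fun i : Fin n => n - 1 - i) =
      (-1) ^ (n * (n - 1) / 2) * oddAlternant (p + n) X := by
  have h := sum_selfConjs_alternating (R := MvPolynomial (Fin n) ℤ) n
    (fun j (k : Fin n) => (X k : MvPolynomial (Fin n) ℤ) ^ j)
    (fun j k => X k ^ (p + n + n - 1 - j)) Matrix.detRowAlternating
  have hodd : oddAlternant (p + n) X = Matrix.detRowAlternating fun j : Fin n =>
      ((fun k : Fin n => (X k : MvPolynomial (Fin n) ℤ) ^ (j : ℕ)) -
        fun k => X k ^ (p + n + n - 1 - j)) := rfl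
  rw [hodd, Finset.sum_mul]
  simp only [zsmul_eq_mul, Int.cast_pow, Int.cast_neg, Int.cast_one] at h
  rw [← h]
  refine Finset.sum_congr rfl fun μ hμ => ?_
  have hμ := mem_selfConjs.1 hμ
  rw [mul_assoc, schur_mul_alternant _ _ (by simp [hμ.augP_apply, hμ.eq_zero le_rfl])]
  congr 1
  rw [alternant]
  change Matrix.detRowAlternating _ = _
  congr 1
  funext i k
  have := hμ.2 i
  have := i.is_lt
  change X k ^ (augP p μ i + (n - 1 - i)) = _
  rw [hμ.augP_apply, selectRow]
  split_ifs with hi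
  · congr 1
    omega
  · congr 1
    omega

theorem parafermionic_identity (n p : ℕ) :
    (∑ f : {f : Fin n → Fin (n + 1) // IsSCBox n f},
        ((-1 : MvPolynomial (Fin n) ℤ) ^
            ((psize (extN fun i => ((f : Fin n → Fin (n + 1)) i : ℕ)) +
              prank (extN fun i => ((f : Fin n → Fin (n + 1)) i : ℕ))) / 2)) *
          schur n (augP p (extN fun i => ((f : Fin n → Fin (n + 1)) i : ℕ)))) =
    (∑ g : {g : Fin n → Fin (p + 1) // Antitone g},
        schur n (extN fun i => ((g : Fin n → Fin (p + 1)) i : ℕ))) *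
      (∏ i : Fin n, (1 - X i)) *
      ∏ q ∈ Finset.univ.filter (fun q : Fin n × Fin n => q.1 < q.2),
        (1 - X q.1 * X q.2) := by
  refine mul_right_cancel₀ (alternant_staircase_ne_zero (MvPolynomial.X_injective)) ?_
  rw [sum_isSCBox n fun μ => (-1 : MvPolynomial (Fin n) ℤ) ^ ((psize μ + prank μ) / 2) *
    schur n (augP p μ), sum_selfConjs_schur, ← alternantSum_X_mul_pairProd,
    ← sum_antitone_schur, pairProd]
  ring
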